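/- Let P ⊆ ℝⁿ be a bounded convex set of positive Lebesgue measure. Then the set S_P is convex and compact. -/

import Mathlib

open MvPolynomial

/-- A monomial order on ℕⁿ: a linear order (total, antisymmetric, transitive)
that is a well-order and is compatible with addition. -/
def IsMonomialOrder (n : ℕ) (r : (Fin n → ℕ) → (Fin n → ℕ) → Prop) : Prop :=
  (∀ a b, r a b ∨ r b a) ∧
  (∀ a b, r a b → r b a → a = b) ∧
  (∀ a b c, r a b → r b c → r a c) ∧
  WellFounded (fun a b => r a b ∧ a ≠ b) ∧
  (∀ a b c, r a b → r (a + c) (b + c))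

/-- `e` is the exponent of the leading monomial of `p` w.r.t. the monomial order `r`. -/
def IsLeadMon {n : ℕ} (r : (Fin n → ℕ) → (Fin n → ℕ) → Prop)
    (p : MvPolynomial (Fin n) ℝ) (e : Fin n → ℕ) : Prop :=
  (∃ d ∈ p.support, ⇑d = e) ∧ ∀ d ∈ p.support, r (⇑d) e

/-- `E_A`: the set of exponents `e` such that no (nonzero) polynomial vanishing on `A`
has leading monomial `X^e`. -/
def ESet {n : ℕ} (r : (Fin n → ℕ) → (Fin n → ℕ) → Prop)
    (A : Set (Fin n → ℝ)) : Set (Fin n → ℕ) :=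
  {e | ¬ ∃ p : MvPolynomial (Fin n) ℝ, (∀ a ∈ A, eval a p = 0) ∧ IsLeadMon r p e}

open Pointwise MeasureTheory

/-- The lattice `ℤⁿ` viewed as a subset of `ℝⁿ`. -/
def latticePoints (n : ℕ) : Set (Fin n → ℝ) := {x | ∀ i, ∃ m : ℤ, x i = (m : ℝ)}

/-- `S_P`: the closure of the increasing union `⋃ₖ 2⁻ᵏ·E_{2ᵏ·P ∩ ℤⁿ}`,
viewing each `E_{2ᵏ·P ∩ ℤⁿ} ⊆ ℕⁿ` as a subset of `ℝⁿ`. -/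
noncomputable def SP {n : ℕ} (r : (Fin n → ℕ) → (Fin n → ℕ) → Prop)
    (P : Set (Fin n → ℝ)) : Set (Fin n → ℝ) :=
  closure (⋃ k : ℕ,
    (fun (e : Fin n → ℕ) (i : Fin n) => (e i : ℝ) / 2 ^ k) ''
      ESet r (((2 ^ k : ℝ) • P) ∩ latticePoints n))

/-! ### Closed midpoint-convex sets are convex -/

lemma Icc_subset_of_isClosed_of_midpoint_mem {T : Set ℝ} (hT : IsClosed T)
    (hmid : ∀ s ∈ T, ∀ t ∈ T, (s + t) / 2 ∈ T) {a b : ℝ} (ha : a ∈ T) (hb : b ∈ T) :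
    Set.Icc a b ⊆ T := by
  intro t ht
  obtain ⟨u, ⟨huT, hu⟩, hu'⟩ := (isCompact_Icc.inter_left hT).exists_isGreatest
    (⟨a, ha, le_rfl, ht.1⟩ : (T ∩ Set.Icc a t).Nonempty)
  obtain ⟨v, ⟨hvT, hv⟩, hv'⟩ := (isCompact_Icc.inter_left hT).exists_isLeast
    (⟨b, hb, ht.2, le_rfl⟩ : (T ∩ Set.Icc t b).Nonempty)
  have hm := hmid u huT v hvT
  rcases le_total ((u + v) / 2) t with h | h
  · have := hu' ⟨hm, by linarith [hu.1, hu.2, hv.1], h⟩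
    obtain rfl : t = u := by linarith [hu.2, hv.1]
    exact huT
  · have := hv' ⟨hm, h, by linarith [hv.2, hv.1, hu.2]⟩
    obtain rfl : t = v := by linarith [hu.2, hv.1]
    exact hvT

lemma convex_of_isClosed_of_midpoint_mem {E : Type*} [AddCommGroup E] [Module ℝ E]
    [TopologicalSpace E] [ContinuousAdd E] [ContinuousSMul ℝ E] {S : Set E} (hS : IsClosed S)
    (hmid : ∀ x ∈ S, ∀ y ∈ S, (2⁻¹ : ℝ) • (x + y) ∈ S) : Convex ℝ S := by
  rw [convex_iff_segment_subset]
  intro x hx y hy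
  rw [segment_eq_image']
  rintro _ ⟨t, ht, rfl⟩
  let T : Set ℝ := {t | x + t • (y - x) ∈ S}
  have hT : IsClosed T := hS.preimage (by fun_prop)
  refine Icc_subset_of_isClosed_of_midpoint_mem hT (fun s hs t ht => ?_)
    (show (0 : ℝ) ∈ T by simpa [T] using hx) (show (1 : ℝ) ∈ T by simpa [T] using hy) ht
  have := hmid _ hs _ ht
  simp only [T, Set.mem_ofPred_eq]
  convert this using 1
  module

/-! ### Monomial orders -/

namespace IsMonomialOrder

variable {n : ℕ} {r : (Fin n → ℕ) → (Fin n → ℕ) → Prop}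

lemma zero_le (hr : IsMonomialOrder n r) (a : Fin n → ℕ) : r 0 a := by
  obtain ⟨total, -, -, wf, add⟩ := hr
  rcases total 0 a with h | h
  · exact h
  obtain ⟨b, -, hb⟩ := wf.has_min Set.univ ⟨0, trivial⟩
  have hab : a + b = b := by
    by_contra hne
    exact hb (a + b) trivial ⟨by simpa using add a 0 b h, hne⟩
  obtain rfl : a = 0 := by simpa using hab
  exact h

lemma le_of_le (hr : IsMonomialOrder n r) {a b : Fin n → ℕ} (h : a ≤ b) : r a b := by
  have := hr.2.2.2.2 0 (b - a) a (hr.zero_le _)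
  rwa [zero_add, tsub_add_cancel_of_le h] at this

/-- In a sum of two exponents bounded by `e + f`, one summand is smaller than its bound, or both
bounds are attained. -/
lemma lt_or_lt_or_eq (hr : IsMonomialOrder n r) {d d' e f : Fin n → ℕ}
    (h : r (d + d') (e + f)) :
    (r d e ∧ d ≠ e) ∨ (r d' f ∧ d' ≠ f) ∨ (d = e ∧ d' = f) := by
  obtain ⟨total, antisymm, trans, -, add⟩ := hr
  by_cases h1 : r d e ∧ d ≠ e
  · exact Or.inl h1
  by_cases h2 : r d' f ∧ d' ≠ f
  · exact Or.inr (Or.inl h2)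
  have hed : r e d := by
    rcases total d e with h | h
    · by_cases hde : d = e
      · subst hde; exact h
      · exact (h1 ⟨h, hde⟩).elim
    · exact h
  have hfd : r f d' := by
    rcases total d' f with h | h
    · by_cases hde : d' = f
      · subst hde; exact h
      · exact (h2 ⟨h, hde⟩).elim
    · exact h
  have A : r (e + f) (d + f) := add _ _ _ hed
  have B : r (d + f) (d + d') := by simpa [add_comm] using add _ _ d hfd
  have e1 : d + f = d + d' := antisymm _ _ B (trans _ _ _ h A)
  have e2 : e + f = d + f := antisymm _ _ A (trans _ _ _ B h)
  exact Or.inr (Or.inr ⟨(add_right_cancel e2).symm, (add_left_cancel e1).symm⟩)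

end IsMonomialOrder

/-! ### Functionals witnessing standard monomials -/

section Functionals

variable {n : ℕ} {r : (Fin n → ℕ) → (Fin n → ℕ) → Prop}

/-- The monomial `X^e` for an exponent given as a function. -/
noncomputable def expMonomial (e : Fin n → ℕ) : MvPolynomial (Fin n) ℝ := ∏ i, X i ^ e i

lemma expMonomial_coe (d : Fin n →₀ ℕ) : expMonomial (⇑d) = monomial d (1 : ℝ) := by
  rw [monomial_eq, expMonomial, Finsupp.prod_fintype _ _ (by simp)]
  simp

lemma expMonomial_add (d e : Fin n → ℕ) :
    expMonomial (d + e) = expMonomial d * expMonomial e := by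
  simp [expMonomial, pow_add, Finset.prod_mul_distrib]

lemma map_eq_sum_expMonomial (L : MvPolynomial (Fin n) ℝ →ₗ[ℝ] ℝ)
    (p : MvPolynomial (Fin n) ℝ) :
    L p = ∑ d ∈ p.support, p.coeff d * L (expMonomial (⇑d)) := by
  conv_lhs => rw [p.as_sum]
  rw [map_sum]
  refine Finset.sum_congr rfl fun d _ => ?_
  rw [expMonomial_coe, ← smul_eq_mul, ← map_smul, smul_monomial, smul_eq_mul, mul_one]

/-- `L` annihilates the polynomials vanishing on `A` and the monomials below `X^e`, but not `X^e`
itself. -/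
structure IsStandardWitness (r : (Fin n → ℕ) → (Fin n → ℕ) → Prop) (A : Set (Fin n → ℝ))
    (e : Fin n → ℕ) (L : MvPolynomial (Fin n) ℝ →ₗ[ℝ] ℝ) : Prop where
  map_of_vanish : ∀ p, (∀ a ∈ A, eval a p = 0) → L p = 0
  map_lower : ∀ d, r d e → d ≠ e → L (expMonomial d) = 0
  map_self : L (expMonomial e) ≠ 0

lemma exists_isStandardWitness (hr : IsMonomialOrder n r) {A : Set (Fin n → ℝ)}
    {e : Fin n → ℕ} (he : e ∈ ESet r A) : ∃ L, IsStandardWitness r A e L := by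
  let V : Submodule ℝ (MvPolynomial (Fin n) ℝ) :=
    { carrier := {p | ∀ a ∈ A, eval a p = 0}
      add_mem' := fun hp hq a ha => by simp [hp a ha, hq a ha]
      zero_mem' := fun a _ => by simp
      smul_mem' := fun c p hp a ha => by simp [hp a ha] }
  let W : Submodule ℝ (MvPolynomial (Fin n) ℝ) :=
    { carrier := {p | ∀ d : Fin n →₀ ℕ, ¬ (r d e ∧ ⇑d ≠ e) → coeff d p = 0}
      add_mem' := fun hp hq d hd => by simp [hp d hd, hq d hd]
      zero_mem' := fun d _ => by simp
      smul_mem' := fun c p hp d hd => by simp [hp d hd] }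
  obtain ⟨d₀, rfl⟩ : ∃ d₀ : Fin n →₀ ℕ, ⇑d₀ = e :=
    ⟨Finsupp.equivFunOnFinite.symm e, by simp⟩
  have hnot : expMonomial (⇑d₀) ∉ V ⊔ W := by
    intro hmem
    obtain ⟨p, hp, s, hs, hps⟩ := Submodule.mem_sup.1 hmem
    have hcoeff : ∀ d, coeff d p = (if d₀ = d then 1 else 0) - coeff d s := by
      intro d
      rw [← coeff_monomial, ← expMonomial_coe, ← hps, coeff_add, add_sub_cancel_right]
    refine he ⟨p, hp, ⟨d₀, ?_, rfl⟩, fun d hd => ?_⟩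
    · rw [mem_support_iff, hcoeff, hs d₀ (by simp)]
      simp
    · by_contra hrd
      have hne : d₀ ≠ d := by
        rintro rfl
        exact hrd (hr.le_of_le le_rfl)
      rw [mem_support_iff, hcoeff, hs d (fun h => hrd h.1), if_neg hne] at hd
      simp at hd
  obtain ⟨L, hL, hker⟩ := Submodule.exists_le_ker_of_notMem hnot
  refine ⟨L, fun p hp => hker (Submodule.mem_sup_left hp), fun d hd hne => ?_, hL⟩
  refine hker (Submodule.mem_sup_right ?_)
  obtain ⟨d₁, rfl⟩ : ∃ d₁ : Fin n →₀ ℕ, ⇑d₁ = d :=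
    ⟨Finsupp.equivFunOnFinite.symm d, by simp⟩
  intro d' hd'
  rw [expMonomial_coe, coeff_monomial, if_neg]
  rintro rfl
  exact hd' ⟨hd, hne⟩

lemma IsStandardWitness.mem_ESet {A : Set (Fin n → ℝ)} {e : Fin n → ℕ}
    {L : MvPolynomial (Fin n) ℝ →ₗ[ℝ] ℝ} (hL : IsStandardWitness r A e L) : e ∈ ESet r A := by
  rintro ⟨p, hp, ⟨d, hd, rfl⟩, hle⟩
  have h := hL.map_of_vanish p hp
  rw [map_eq_sum_expMonomial, Finset.sum_eq_single d] at h
  · exact mul_ne_zero (mem_support_iff.1 hd) hL.map_self h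
  · intro b hb hbd
    rw [hL.map_lower _ (hle b hb) (fun h => hbd (DFunLike.coe_injective h)), mul_zero]
  · exact fun h => (h hd).elim

lemma ESet_mono {A B : Set (Fin n → ℝ)} (h : A ⊆ B) : ESet r A ⊆ ESet r B :=
  fun _ he ⟨p, hp, hl⟩ => he ⟨p, fun a ha => hp a (h ha), hl⟩

open scoped TensorProduct

/-- The comultiplication `X i ↦ X i ⊗ 1 + 1 ⊗ X i` dual to addition of points. -/
noncomputable def addComul (n : ℕ) :
    MvPolynomial (Fin n) ℝ →ₐ[ℝ] MvPolynomial (Fin n) ℝ ⊗[ℝ] MvPolynomial (Fin n) ℝ :=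
  aeval fun i => X i ⊗ₜ 1 + 1 ⊗ₜ X i

/-- The convolution of two functionals on polynomials. -/
noncomputable def addConvolution (L M : MvPolynomial (Fin n) ℝ →ₗ[ℝ] ℝ) :
    MvPolynomial (Fin n) ℝ →ₗ[ℝ] ℝ :=
  LinearMap.mul' ℝ ℝ ∘ₗ TensorProduct.map L M ∘ₗ (addComul n).toLinearMap

lemma addComul_expMonomial (g : Fin n → ℕ) :
    addComul n (expMonomial g) =
      ∑ φ ∈ Fintype.piFinset fun i => Finset.HasAntidiagonal.antidiagonal (g i),
        (∏ i, (g i).choose (φ i).1) •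
          (expMonomial (fun i => (φ i).1) ⊗ₜ[ℝ] expMonomial (fun i => (φ i).2)) := by
  simp only [addComul, expMonomial, map_prod, map_pow, aeval_X]
  have hpow (i : Fin n) := Commute.add_pow'
    (Commute.all (X i ⊗ₜ[ℝ] 1) (1 ⊗ₜ[ℝ] X i : MvPolynomial (Fin n) ℝ ⊗[ℝ] MvPolynomial (Fin n) ℝ))
    (g i)
  simp_rw [hpow]
  rw [Finset.prod_univ_sum]
  refine Finset.sum_congr rfl fun φ _ => ?_
  simp only [nsmul_eq_mul, Finset.prod_mul_distrib, Nat.cast_prod]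
  congr 1
  simp only [Algebra.TensorProduct.tmul_pow, one_pow]
  rw [← Finset.prod_mul_distrib]
  simp only [Algebra.TensorProduct.tmul_mul_tmul, one_mul, mul_one]
  induction (Finset.univ : Finset (Fin n)) using Finset.cons_induction with
  | empty => simp [Algebra.TensorProduct.one_def]
  | cons a s ha ih => simp only [Finset.prod_cons, ih, Algebra.TensorProduct.tmul_mul_tmul]

lemma addConvolution_expMonomial (L M : MvPolynomial (Fin n) ℝ →ₗ[ℝ] ℝ) (g : Fin n → ℕ) :
    addConvolution L M (expMonomial g) =
      ∑ φ ∈ Fintype.piFinset fun i => Finset.HasAntidiagonal.antidiagonal (g i),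
        (∏ i, (g i).choose (φ i).1 : ℕ) *
          (L (expMonomial fun i => (φ i).1) * M (expMonomial fun i => (φ i).2)) := by
  simp only [addConvolution, LinearMap.comp_apply, AlgHom.toLinearMap_apply, addComul_expMonomial,
    map_sum, map_nsmul, TensorProduct.map_tmul, LinearMap.mul'_apply]
  simp only [nsmul_eq_mul]

lemma addConvolution_eq_zero_of_vanish {A B : Set (Fin n → ℝ)}
    {L M : MvPolynomial (Fin n) ℝ →ₗ[ℝ] ℝ}
    (hL : ∀ p, (∀ a ∈ A, eval a p = 0) → L p = 0)
    (hM : ∀ p, (∀ b ∈ B, eval b p = 0) → M p = 0)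
    {p : MvPolynomial (Fin n) ℝ} (hp : ∀ c ∈ A + B, eval c p = 0) :
    addConvolution L M p = 0 := by
  have map_slice : ∀ t : MvPolynomial (Fin n) ℝ ⊗[ℝ] MvPolynomial (Fin n) ℝ,
      LinearMap.mul' ℝ ℝ (TensorProduct.map L M t) =
        M (TensorProduct.lid ℝ _ (LinearMap.rTensor _ L t)) := by
    intro t
    induction t with
    | zero => simp
    | tmul x y => simp
    | add x y hx hy => simp only [map_add, hx, hy]
  have eval_slice : ∀ (b : Fin n → ℝ) (t : MvPolynomial (Fin n) ℝ ⊗[ℝ] MvPolynomial (Fin n) ℝ),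
      eval b (TensorProduct.lid ℝ _ (LinearMap.rTensor _ L t)) =
        L (TensorProduct.rid ℝ _ (LinearMap.lTensor _ (aeval b).toLinearMap t)) := by
    intro b t
    induction t with
    | zero => simp
    | tmul x y => simp [mul_comm, aeval_eq_eval]
    | add x y hx hy => simp only [map_add, hx, hy]
  have eval_add : ∀ (a b : Fin n → ℝ),
      (aeval a).comp ((Algebra.TensorProduct.rid ℝ ℝ _).toAlgHom.comp
        ((Algebra.TensorProduct.map (AlgHom.id ℝ _) (aeval b)).comp (addComul n))) =
        (aeval (a + b) : MvPolynomial (Fin n) ℝ →ₐ[ℝ] ℝ) := by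
    intro a b
    ext i
    simp [addComul]
  change LinearMap.mul' ℝ ℝ (TensorProduct.map L M (addComul n p)) = 0
  rw [map_slice]
  refine hM _ fun b hb => ?_
  rw [eval_slice]
  refine hL _ fun a ha => ?_
  have h := DFunLike.congr_fun (eval_add a b) p
  have h0 := hp _ (Set.add_mem_add ha hb)
  rw [← aeval_eq_eval] at h0 ⊢
  exact h.trans h0

lemma IsStandardWitness.addConvolution (hr : IsMonomialOrder n r) {A B : Set (Fin n → ℝ)}
    {e f : Fin n → ℕ} {L M : MvPolynomial (Fin n) ℝ →ₗ[ℝ] ℝ} (hL : IsStandardWitness r A e L)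
    (hM : IsStandardWitness r B f M) :
    IsStandardWitness r (A + B) (e + f) (addConvolution L M) where
  map_of_vanish _ hp := addConvolution_eq_zero_of_vanish hL.map_of_vanish hM.map_of_vanish hp
  map_lower g hg hne := by
    rw [addConvolution_expMonomial]
    refine Finset.sum_eq_zero fun φ hφ => ?_
    have hsum : (fun i => (φ i).1) + (fun i => (φ i).2) = g := by
      ext i
      simpa using Fintype.mem_piFinset.1 hφ i
    rcases hr.lt_or_lt_or_eq (hsum.symm ▸ hg) with h | h | h
    · rw [hL.map_lower _ h.1 h.2]; simp
    · rw [hM.map_lower _ h.1 h.2]; simp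
    · rw [h.1, h.2] at hsum
      exact (hne hsum.symm).elim
  map_self := by
    rw [addConvolution_expMonomial, Finset.sum_eq_single fun i => (e i, f i)]
    · refine mul_ne_zero (Nat.cast_ne_zero.2 (Finset.prod_ne_zero_iff.2 fun i _ => ?_))
        (mul_ne_zero hL.map_self hM.map_self)
      exact (Nat.choose_pos (by simp)).ne'
    · intro φ hφ hne
      have hsum : (fun i => (φ i).1) + (fun i => (φ i).2) = e + f := by
        ext i
        simpa using Fintype.mem_piFinset.1 hφ i
      rcases hr.lt_or_lt_or_eq (hr.le_of_le hsum.le) with h | h | h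
      · rw [hL.map_lower _ h.1 h.2]; simp
      · rw [hM.map_lower _ h.1 h.2]; simp
      · exact (hne (funext fun i => Prod.ext (congrFun h.1 i) (congrFun h.2 i))).elim
    · intro h
      simp [Fintype.mem_piFinset] at h

/-- Standard exponents of a sumset contain the sums of standard exponents. -/
lemma add_mem_ESet (hr : IsMonomialOrder n r) {A B : Set (Fin n → ℝ)} {e f : Fin n → ℕ}
    (he : e ∈ ESet r A) (hf : f ∈ ESet r B) : e + f ∈ ESet r (A + B) := by
  obtain ⟨L, hL⟩ := exists_isStandardWitness hr he
  obtain ⟨M, hM⟩ := exists_isStandardWitness hr hf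
  exact (hL.addConvolution hr hM).mem_ESet

/-- If a coordinate takes at most `s.card` values on `A`, then that coordinate of a standard
exponent is less than `s.card`. -/
lemma lt_card_of_mem_ESet (hr : IsMonomialOrder n r) {A : Set (Fin n → ℝ)} {e : Fin n → ℕ}
    (he : e ∈ ESet r A) (i : Fin n) (s : Finset ℝ) (hs : ∀ a ∈ A, a i ∈ s) : e i < s.card := by
  by_contra! hlt
  obtain ⟨L, hL⟩ := exists_isStandardWitness hr he
  let Q : Polynomial ℝ := ∏ c ∈ s, (Polynomial.X - Polynomial.C c)
  have hmonic : Q.Monic := Polynomial.monic_prod_of_monic _ _ fun c _ => Polynomial.monic_X_sub_C c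
  have hdeg : Q.natDegree = s.card := by simp [Q]
  let e' : Fin n → ℕ := e - Pi.single i s.card
  have hexp : ∀ k, expMonomial e' * X i ^ k = expMonomial (e' + Pi.single i k) := by
    intro k
    rw [expMonomial_add]
    congr 1
    rw [expMonomial, Finset.prod_eq_single i (by intro j _ hj; simp [hj]) (by simp)]
    simp
  have htop : e' + Pi.single i s.card = e := by
    refine tsub_add_cancel_of_le fun j => ?_
    by_cases hj : j = i
    · subst hj; simpa using hlt
    · simp [hj]
  have h := hL.map_of_vanish (expMonomial e' * Polynomial.aeval (X i) Q) fun a ha => by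
    rw [map_mul, map_prod, map_prod, Finset.prod_eq_zero (hs a ha) (by simp [algebraMap_eq]),
      mul_zero]
  rw [Polynomial.aeval_eq_sum_range, hdeg, Finset.mul_sum, map_sum, Finset.sum_range_succ,
    Finset.sum_eq_zero, zero_add] at h
  · rw [mul_smul_comm, hexp, htop, map_smul, ← hdeg, hmonic.coeff_natDegree, one_smul] at h
    exact hL.map_self h
  · intro k hk
    rw [Finset.mem_range] at hk
    rw [mul_smul_comm, hexp, map_smul, hL.map_lower, smul_zero]
    · rw [← htop]
      exact hr.le_of_le (add_le_add_right (Pi.single_le_single.2 hk.le) _)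
    · intro heq
      have := congrFun (heq.trans htop.symm) i
      simp at this
      omega

end Functionals

/-! ### The limit shape -/

lemma smul_inter_latticePoints_add_subset {n : ℕ} {P : Set (Fin n → ℝ)} (hc : Convex ℝ P)
    (k l : ℕ) :
    ((2 ^ k : ℝ) • P ∩ latticePoints n) + ((2 ^ l : ℝ) • P ∩ latticePoints n) ⊆
      ((2 ^ k + 2 ^ l : ℝ) • P) ∩ latticePoints n := by
  rintro _ ⟨x, ⟨hx, hxl⟩, y, ⟨hy, hyl⟩, rfl⟩
  refine ⟨?_, fun i => ?_⟩
  · rw [hc.add_smul (by positivity) (by positivity)]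
    exact Set.add_mem_add hx hy
  · obtain ⟨a, ha⟩ := hxl i
    obtain ⟨b, hb⟩ := hyl i
    exact ⟨a + b, by simp [ha, hb]⟩

section LimitShape

variable {n : ℕ} {r : (Fin n → ℕ) → (Fin n → ℕ) → Prop} {P : Set (Fin n → ℝ)}

lemma add_mem_ESet_succ (hr : IsMonomialOrder n r) (hc : Convex ℝ P) {k : ℕ} {e f : Fin n → ℕ}
    (he : e ∈ ESet r ((2 ^ k : ℝ) • P ∩ latticePoints n))
    (hf : f ∈ ESet r ((2 ^ k : ℝ) • P ∩ latticePoints n)) :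
    e + f ∈ ESet r ((2 ^ (k + 1) : ℝ) • P ∩ latticePoints n) := by
  have h := ESet_mono (smul_inter_latticePoints_add_subset hc k k) (add_mem_ESet hr he hf)
  rwa [← two_mul, ← pow_succ'] at h

lemma two_pow_smul_mem_ESet (hr : IsMonomialOrder n r) (hc : Convex ℝ P) {k : ℕ}
    {e : Fin n → ℕ} (he : e ∈ ESet r ((2 ^ k : ℝ) • P ∩ latticePoints n)) (m : ℕ) :
    2 ^ m • e ∈ ESet r ((2 ^ (k + m) : ℝ) • P ∩ latticePoints n) := by
  induction m with
  | zero => simpa using he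
  | succ m ih =>
    rw [pow_succ', mul_smul, two_smul]
    exact add_mem_ESet_succ hr hc ih ih

lemma convex_SP (hr : IsMonomialOrder n r) (hc : Convex ℝ P) : Convex ℝ (SP r P) := by
  refine convex_of_isClosed_of_midpoint_mem isClosed_closure fun x hx y hy => ?_
  refine map_mem_closure₂ (f := fun x y : Fin n → ℝ => (2⁻¹ : ℝ) • (x + y)) (by fun_prop) hx hy ?_
  intro x hx y hy
  obtain ⟨k, e, he, rfl⟩ := Set.mem_iUnion.1 hx
  obtain ⟨l, f, hf, rfl⟩ := Set.mem_iUnion.1 hy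
  have he' := two_pow_smul_mem_ESet hr hc he l
  have hf' := two_pow_smul_mem_ESet hr hc hf k
  rw [add_comm l k] at hf'
  refine Set.mem_iUnion.2 ⟨k + l + 1, _, add_mem_ESet_succ hr hc he' hf', ?_⟩
  ext i
  simp [pow_add]
  field_simp

lemma isBounded_SP (hr : IsMonomialOrder n r) (hb : Bornology.IsBounded P) :
    Bornology.IsBounded (SP r P) := by
  obtain ⟨R, hR⟩ := hb.exists_norm_le
  obtain ⟨N, hN⟩ := exists_nat_ge R
  refine Bornology.IsBounded.closure
    (isBounded_iff_forall_norm_le.2 ⟨2 * N + 1, fun x hx => ?_⟩)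
  obtain ⟨k, e, he, rfl⟩ := Set.mem_iUnion.1 hx
  refine (pi_norm_le_iff_of_nonneg (by positivity)).2 fun i => ?_
  let s : Finset ℝ := (Finset.Icc (-(2 ^ k * N : ℤ)) (2 ^ k * N)).image (fun m : ℤ => (m : ℝ))
  have hcard : s.card ≤ 2 * (2 ^ k * N) + 1 := by
    refine Finset.card_image_le.trans ?_
    rw [Int.card_Icc, Int.toNat_le]
    push_cast
    linarith
  have hlt := lt_card_of_mem_ESet hr he i s fun a ha => by
    obtain ⟨⟨x, hx, rfl⟩, hl⟩ := ha
    obtain ⟨m, hm⟩ := hl i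
    refine Finset.mem_image.2 ⟨m, ?_, hm.symm⟩
    have hxi : |x i| ≤ N := (norm_le_pi_norm x i).trans ((hR x hx).trans hN)
    have hm' : |(m : ℝ)| ≤ 2 ^ k * N := by
      rw [← hm]
      simp only [Pi.smul_apply, smul_eq_mul, abs_mul, abs_pow, Nat.abs_ofNat]
      gcongr
    have hm'' : |m| ≤ 2 ^ k * N := by exact_mod_cast hm'
    exact Finset.mem_Icc.2 (abs_le.1 hm'')
  have hle : (e i : ℝ) ≤ 2 * (2 ^ k * N) := by
    exact_mod_cast Nat.lt_succ_iff.1 (hlt.trans_le hcard)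
  have hpow : (0 : ℝ) < 2 ^ k := by positivity
  rw [Real.norm_of_nonneg (by positivity), div_le_iff₀ hpow]
  nlinarith

end LimitShape

/-- For a bounded convex set `P ⊆ ℝⁿ` of positive Lebesgue measure,
`S_P` is convex and compact. -/
theorem SP_convex_isCompact {n : ℕ}
    (r : (Fin n → ℕ) → (Fin n → ℕ) → Prop) (hr : IsMonomialOrder n r)
    (P : Set (Fin n → ℝ)) (hb : Bornology.IsBounded P) (hc : Convex ℝ P)
    (hv : 0 < volume P) :
    Convex ℝ (SP r P) ∧ IsCompact (SP r P) := by
  exact ⟨convex_SP hr hc, Metric.isCompact_of_isClosed_isBounded isClosed_closure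
    (isBounded_SP hr hb)⟩
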